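/- Let (M_p)_{p∈ℕ₀} be a sequence of positive real numbers satisfying condition (M.1) and M_0 = 1. Let φ₁, φ₂ : ℝ^d → ℂ be smooth functions such that ‖φ₁‖_{(s_p)} < ∞ and ‖φ₂‖_{(s_p)} < ∞ for every (s_p) ∈ 𝔯. Then ‖φ₁·φ₂‖_{(s_p)} < ∞ for every (s_p) ∈ 𝔯, and moreover, for every (r_p) ∈ 𝔯 with r_1 > 2 the inequality ‖φ₁·φ₂‖_{(r_p)} ≤ ‖φ₁‖_{(r_p)/2} · ‖φ₂‖_{(r_p)/2} holds, where (r_p)/2 denotes the sequence (r̄_p) with r̄_0 = 1 and r̄_p = r_p/2 for p ≥ 1 (which belongs to 𝔯). -/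

import Mathlib

open scoped ENNReal

noncomputable section

/-- The class 𝔯: positive sequences with `r 0 = 1`, monotonically increasing,
tending to infinity. -/
def IsRSeq (r : ℕ → ℝ) : Prop :=
  r 0 = 1 ∧ (∀ p, 0 < r p) ∧ Monotone r ∧ Filter.Tendsto r Filter.atTop Filter.atTop

/-- The product sequence `R p = r 0 * r 1 * ⋯ * r p` (so `R 0 = r 0 = 1`). -/
def prodSeq (r : ℕ → ℝ) (p : ℕ) : ℝ := ∏ i ∈ Finset.range (p + 1), r i

/-- The one-dimensional operator `D_m = (1/i) ∂/∂x_m` acting on functions on `ℝ^d`. -/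
def Dm {d : ℕ} (m : Fin d) (f : (Fin d → ℝ) → ℂ) : (Fin d → ℝ) → ℂ :=
  fun x => -Complex.I * fderiv ℝ f x (Pi.single m 1)

/-- The multi-index derivative `D^k = D_1^{k_1} ⋯ D_d^{k_d}`. -/
def Dmulti {d : ℕ} (k : Fin d → ℕ) (f : (Fin d → ℝ) → ℂ) : (Fin d → ℝ) → ℂ :=
  ((List.ofFn fun m : Fin d => (Dm m)^[k m]).foldr (· ∘ ·) id) f

/-- The seminorm `‖φ‖_{(r_p)} = sup_k ‖D^k φ‖_∞ / (R_{|k|} M_{|k|})`, valued in `ℝ≥0∞`. -/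
def MRNorm {d : ℕ} (M r : ℕ → ℝ) (φ : (Fin d → ℝ) → ℂ) : ℝ≥0∞ :=
  ⨆ k : Fin d → ℕ, (⨆ x, (‖Dmulti k φ x‖₊ : ℝ≥0∞)) /
    ENNReal.ofReal (prodSeq r (∑ m, k m) * M (∑ m, k m))

/-- The sequence `(r_p)/2`: equal to `1` at `p = 0` and to `r p / 2` for `p ≥ 1`. -/
def halfSeq (r : ℕ → ℝ) : ℕ → ℝ := fun p => if p = 0 then 1 else r p / 2

/-- Derivative along a word of coordinate indices. -/
def Dword {d : ℕ} (w : List (Fin d)) (f : (Fin d → ℝ) → ℂ) : (Fin d → ℝ) → ℂ :=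
  w.foldr (fun m g => Dm m g) f

/-- The sorted word attached to a multi-index. -/
def kword {d : ℕ} (k : Fin d → ℕ) : List (Fin d) :=
  (List.ofFn fun m : Fin d => List.replicate (k m) m).flatten

/-- All splittings of a word into a subword and its complement. -/
def wsplits {α : Type} : List α → List (List α × List α)
  | [] => [([], [])]
  | a :: w => (wsplits w).map (fun p => (a :: p.1, p.2)) ++
      (wsplits w).map (fun p => (p.1, a :: p.2))

lemma wsplits_length {α : Type} (w : List α) : (wsplits w).length = 2 ^ w.length := by
  induction w with
  | nil => simp [wsplits]
  | cons a w ih => simp [wsplits, ih, pow_succ]; ring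

lemma wsplits_mem {α : Type} (w : List α) : ∀ p ∈ wsplits w,
    List.Sublist p.1 w ∧ List.Sublist p.2 w ∧ p.1.length + p.2.length = w.length := by
  induction w with
  | nil => simp [wsplits]
  | cons a w ih =>
    intro p hp
    simp only [wsplits, List.mem_append, List.mem_map] at hp
    rcases hp with ⟨q, hq, rfl⟩ | ⟨q, hq, rfl⟩
    · obtain ⟨h1, h2, h3⟩ := ih q hq
      exact ⟨h1.cons_cons a, h2.cons a, by simp; omega⟩
    · obtain ⟨h1, h2, h3⟩ := ih q hq
      exact ⟨h1.cons a, h2.cons_cons a, by simp; omega⟩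

lemma Dm_smooth {d : ℕ} (m : Fin d) (f : (Fin d → ℝ) → ℂ) (hf : ContDiff ℝ (⊤ : ℕ∞) f) :
    ContDiff ℝ (⊤ : ℕ∞) (Dm m f) := by
  unfold Dm
  refine contDiff_const.mul ?_
  exact (hf.fderiv_right (m := (⊤ : ℕ∞)) (by simp)).clm_apply contDiff_const

lemma Dword_smooth {d : ℕ} (w : List (Fin d)) (f : (Fin d → ℝ) → ℂ)
    (hf : ContDiff ℝ (⊤ : ℕ∞) f) : ContDiff ℝ (⊤ : ℕ∞) (Dword w f) := by
  induction w with
  | nil => exact hf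
  | cons a w ih => exact Dm_smooth a _ ih

lemma Dm_mul {d : ℕ} (m : Fin d) (f g : (Fin d → ℝ) → ℂ) (hf : ContDiff ℝ (⊤ : ℕ∞) f)
    (hg : ContDiff ℝ (⊤ : ℕ∞) g) (x : Fin d → ℝ) :
    Dm m (fun x => f x * g x) x = Dm m f x * g x + f x * Dm m g x := by
  have h1 : DifferentiableAt ℝ f x := hf.differentiable (by simp) x
  have h2 : DifferentiableAt ℝ g x := hg.differentiable (by simp) x
  unfold Dm
  rw [fderiv_fun_mul h1 h2]
  simp
  ring

lemma Dm_add {d : ℕ} (m : Fin d) (f g : (Fin d → ℝ) → ℂ) (hf : ContDiff ℝ (⊤ : ℕ∞) f)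
    (hg : ContDiff ℝ (⊤ : ℕ∞) g) (x : Fin d → ℝ) :
    Dm m (fun x => f x + g x) x = Dm m f x + Dm m g x := by
  have h1 : DifferentiableAt ℝ f x := hf.differentiable (by simp) x
  have h2 : DifferentiableAt ℝ g x := hg.differentiable (by simp) x
  unfold Dm
  rw [fderiv_fun_add h1 h2]
  simp
  ring

lemma listsum_smooth {d : ℕ} (f g : (Fin d → ℝ) → ℂ) (hf : ContDiff ℝ (⊤ : ℕ∞) f)
    (hg : ContDiff ℝ (⊤ : ℕ∞) g) (L : List (List (Fin d) × List (Fin d))) :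
    ContDiff ℝ (⊤ : ℕ∞) (fun x => (L.map fun p => Dword p.1 f x * Dword p.2 g x).sum) := by
  induction L with
  | nil => simpa using contDiff_const
  | cons p L ih =>
    simp only [List.map_cons, List.sum_cons]
    exact ((Dword_smooth _ _ hf).mul (Dword_smooth _ _ hg)).add ih

lemma Dm_listsum {d : ℕ} (m : Fin d) (f g : (Fin d → ℝ) → ℂ) (hf : ContDiff ℝ (⊤ : ℕ∞) f)
    (hg : ContDiff ℝ (⊤ : ℕ∞) g) (L : List (List (Fin d) × List (Fin d))) (x : Fin d → ℝ) :
    Dm m (fun x => (L.map fun p => Dword p.1 f x * Dword p.2 g x).sum) x =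
      (L.map fun p => Dword (m :: p.1) f x * Dword p.2 g x).sum +
      (L.map fun p => Dword p.1 f x * Dword (m :: p.2) g x).sum := by
  induction L with
  | nil => simp [Dm]
  | cons p L ih =>
    simp only [List.map_cons, List.sum_cons]
    rw [Dm_add m _ _ ((Dword_smooth _ _ hf).mul (Dword_smooth _ _ hg))
      (listsum_smooth f g hf hg L), ih,
      Dm_mul m _ _ (Dword_smooth _ _ hf) (Dword_smooth _ _ hg)]
    simp only [Dword, List.foldr_cons]
    ring

lemma Dword_mul {d : ℕ} (f g : (Fin d → ℝ) → ℂ) (hf : ContDiff ℝ (⊤ : ℕ∞) f)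
    (hg : ContDiff ℝ (⊤ : ℕ∞) g) (w : List (Fin d)) :
    Dword w (fun x => f x * g x) =
      fun x => ((wsplits w).map fun p => Dword p.1 f x * Dword p.2 g x).sum := by
  induction w with
  | nil => simp [wsplits, Dword]
  | cons a w ih =>
    have : Dword (a :: w) (fun x => f x * g x) = Dm a (Dword w (fun x => f x * g x)) := rfl
    rw [this, ih]
    funext x
    rw [Dm_listsum a f g hf hg]
    simp [wsplits, Function.comp_def]

lemma Dword_append {d : ℕ} (u v : List (Fin d)) (f : (Fin d → ℝ) → ℂ) :
    Dword (u ++ v) f = Dword u (Dword v f) := by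
  simp [Dword]

lemma Dword_replicate {d : ℕ} (n : ℕ) (m : Fin d) (f : (Fin d → ℝ) → ℂ) :
    Dword (List.replicate n m) f = (Dm m)^[n] f := by
  induction n with
  | zero => rfl
  | succ n ih =>
    rw [Function.iterate_succ_apply', ← ih]
    rfl

lemma Dmulti_eq {d : ℕ} (k : Fin d → ℕ) (f : (Fin d → ℝ) → ℂ) :
    Dmulti k f = Dword (kword k) f := by
  unfold Dmulti kword
  rw [List.ofFn_eq_map, List.ofFn_eq_map]
  induction List.finRange d with
  | nil => rfl
  | cons a L ih =>
    simp only [List.map_cons, List.foldr_cons, List.flatten_cons, Function.comp_apply,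
      Dword_append, Dword_replicate]
    rw [ih]

lemma kword_count {d : ℕ} (k : Fin d → ℕ) (m : Fin d) : (kword k).count m = k m := by
  unfold kword
  rw [List.count_flatten, List.map_ofFn, List.sum_ofFn]
  simp [List.count_replicate]

lemma kword_sorted {d : ℕ} (k : Fin d → ℕ) : (kword k).Pairwise (· ≤ ·) := by
  unfold kword
  rw [List.pairwise_flatten]
  constructor
  · intro l hl
    obtain ⟨m, rfl⟩ := (List.mem_ofFn' _ _).1 hl
    simp [List.pairwise_replicate]
  · rw [List.pairwise_ofFn]
    intro i j hij x hx y hy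
    rw [List.eq_of_mem_replicate hx, List.eq_of_mem_replicate hy]
    exact hij.le

lemma length_eq_sum {d : ℕ} (u : List (Fin d)) : u.length = ∑ m, u.count m := by
  have := Multiset.sum_count_eq_card (s := (Finset.univ : Finset (Fin d))) (m := (u : Multiset (Fin d)))
    (by simp)
  simpa using this.symm

lemma kword_length {d : ℕ} (k : Fin d → ℕ) : (kword k).length = ∑ m, k m := by
  rw [length_eq_sum]
  simp [kword_count]

lemma kword_of_sorted {d : ℕ} (u : List (Fin d)) (hu : u.Pairwise (· ≤ ·)) :
    kword (fun m => u.count m) = u := by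
  refine List.Perm.eq_of_pairwise' (kword_sorted _) hu ?_
  rw [List.perm_iff_count]
  intro a
  rw [kword_count]

/-- The weight `R_p M_p`. -/
def wt (M r : ℕ → ℝ) (p : ℕ) : ℝ := prodSeq r p * M p

lemma prodSeq_pos (r : ℕ → ℝ) (hr : ∀ p, 0 < r p) (p : ℕ) : 0 < prodSeq r p :=
  Finset.prod_pos fun i _ => hr i

lemma prod_superadd (a : ℕ → ℝ) (ha : ∀ i, 0 < a i) (hm : Monotone a) (j l : ℕ) :
    (∏ i ∈ Finset.range j, a i) * (∏ i ∈ Finset.range l, a i) ≤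
      ∏ i ∈ Finset.range (j + l), a i := by
  rw [Finset.prod_range_add]
  refine mul_le_mul_of_nonneg_left ?_ (Finset.prod_nonneg fun i _ => (ha i).le)
  exact Finset.prod_le_prod (fun i _ => (ha i).le) (fun i _ => hm (by omega))

lemma prodSeq_superadd (r : ℕ → ℝ) (hr : ∀ p, 0 < r p) (hm : Monotone r) (h0 : r 0 = 1)
    (j l : ℕ) : prodSeq r j * prodSeq r l ≤ prodSeq r (j + l) := by
  have h : ∀ p, prodSeq r p = ∏ i ∈ Finset.range p, r (i + 1) := by
    intro p
    rw [prodSeq, Finset.prod_range_succ', h0, mul_one]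
  simp only [h]
  exact prod_superadd (fun i => r (i + 1)) (fun i => hr _) (fun i j hij => hm (by omega)) j l

lemma M_superadd (M : ℕ → ℝ) (hMpos : ∀ p, 0 < M p)
    (hM1 : ∀ p : ℕ, 1 ≤ p → M p ^ 2 ≤ M (p - 1) * M (p + 1)) (hM0 : M 0 = 1)
    (j l : ℕ) : M j * M l ≤ M (j + l) := by
  have h : ∀ p, M p = ∏ i ∈ Finset.range p, (M (i + 1) / M i) := by
    intro p
    induction p with
    | zero => simp [hM0]
    | succ p ih =>
      rw [Finset.prod_range_succ, ← ih, mul_div_cancel₀ _ (hMpos p).ne']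
  rw [h j, h l, h (j + l)]
  refine prod_superadd (fun i => M (i + 1) / M i) (fun i => div_pos (hMpos _) (hMpos _)) ?_ j l
  refine monotone_nat_of_le_succ fun n => ?_
  rw [div_le_div_iff₀ (hMpos _) (hMpos _)]
  have := hM1 (n + 1) (by omega)
  simp only [Nat.add_sub_cancel] at this
  nlinarith

lemma wt_pos (M r : ℕ → ℝ) (hMpos : ∀ p, 0 < M p) (hr : ∀ p, 0 < r p) (p : ℕ) :
    0 < wt M r p := mul_pos (prodSeq_pos r hr p) (hMpos p)

lemma norm_word_le {d : ℕ} (M r : ℕ → ℝ) (hMpos : ∀ p, 0 < M p) (hr : ∀ p, 0 < r p)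
    (f : (Fin d → ℝ) → ℂ) (hf : MRNorm M r f < ⊤) (u : List (Fin d))
    (hu : u.Pairwise (· ≤ ·)) (x : Fin d → ℝ) :
    ‖Dword u f x‖ ≤ (MRNorm M r f).toReal * wt M r u.length := by
  have h1 := le_iSup (fun k : Fin d → ℕ => (⨆ x, (‖Dmulti k f x‖₊ : ℝ≥0∞)) /
    ENNReal.ofReal (prodSeq r (∑ m, k m) * M (∑ m, k m))) (fun m => u.count m)
  change _ ≤ MRNorm M r f at h1
  simp only [← length_eq_sum, Dmulti_eq, kword_of_sorted u hu] at h1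
  change _ / ENNReal.ofReal (wt M r u.length) ≤ _ at h1
  have hw := wt_pos M r hMpos hr u.length
  rw [ENNReal.div_le_iff (by simpa using hw) (by simp)] at h1
  have h2 := (le_iSup (fun x => (‖Dword u f x‖₊ : ℝ≥0∞)) x).trans h1
  have h3 := ENNReal.toReal_mono (ENNReal.mul_ne_top hf.ne (by simp)) h2
  simpa [ENNReal.toReal_mul, ENNReal.toReal_ofReal hw.le] using h3

lemma norm_Dmulti_mul_le {d : ℕ} (M r : ℕ → ℝ) (hMpos : ∀ p, 0 < M p)
    (hM1 : ∀ p : ℕ, 1 ≤ p → M p ^ 2 ≤ M (p - 1) * M (p + 1)) (hM0 : M 0 = 1)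
    (hr : IsRSeq r) (f g : (Fin d → ℝ) → ℂ) (hfs : ContDiff ℝ (⊤ : ℕ∞) f)
    (hgs : ContDiff ℝ (⊤ : ℕ∞) g) (hf : MRNorm M r f < ⊤) (hg : MRNorm M r g < ⊤)
    (k : Fin d → ℕ) (x : Fin d → ℝ) :
    ‖Dmulti k (fun x => f x * g x) x‖ ≤
      (MRNorm M r f * MRNorm M r g).toReal * (2 ^ (∑ m, k m) * wt M r (∑ m, k m)) := by
  obtain ⟨h0, hp, hm, -⟩ := hr
  rw [Dmulti_eq, Dword_mul f g hfs hgs, ← kword_length]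
  set w := kword k with hw
  set C := (MRNorm M r f * MRNorm M r g).toReal * wt M r w.length with hC
  have key : ∀ p ∈ wsplits w, ‖Dword p.1 f x * Dword p.2 g x‖ ≤ C := by
    intro p hpw
    obtain ⟨h1, h2, h3⟩ := wsplits_mem w p hpw
    have e1 := norm_word_le M r hMpos hp f hf p.1 ((kword_sorted k).sublist h1) x
    have e2 := norm_word_le M r hMpos hp g hg p.2 ((kword_sorted k).sublist h2) x
    have e3 : wt M r p.1.length * wt M r p.2.length ≤ wt M r w.length := by
      rw [← h3]
      have a1 := prodSeq_superadd r hp hm h0 p.1.length p.2.length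
      have a2 := M_superadd M hMpos hM1 hM0 p.1.length p.2.length
      have := mul_le_mul a1 a2 (mul_pos (hMpos _) (hMpos _)).le (prodSeq_pos r hp _).le
      unfold wt
      linarith
    rw [norm_mul, hC, ENNReal.toReal_mul]
    calc _ ≤ _ := mul_le_mul e1 e2 (norm_nonneg _)
          (mul_nonneg ENNReal.toReal_nonneg (wt_pos M r hMpos hp _).le)
      _ = ((MRNorm M r f).toReal * (MRNorm M r g).toReal) *
          (wt M r p.1.length * wt M r p.2.length) := by ring
      _ ≤ _ := mul_le_mul_of_nonneg_left e3
          (mul_nonneg ENNReal.toReal_nonneg ENNReal.toReal_nonneg)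
  have gen : ∀ L : List (List (Fin d) × List (Fin d)),
      (∀ p ∈ L, ‖Dword p.1 f x * Dword p.2 g x‖ ≤ C) →
      ‖(L.map fun p => Dword p.1 f x * Dword p.2 g x).sum‖ ≤ L.length * C := by
    intro L
    induction L with
    | nil => simp
    | cons p L ih =>
      intro h
      simp only [List.map_cons, List.sum_cons, List.length_cons]
      have i1 := ih fun q hq => h q (List.mem_cons_of_mem _ hq)
      have i2 := h p List.mem_cons_self
      have i3 := norm_add_le (Dword p.1 f x * Dword p.2 g x)
        (L.map fun p => Dword p.1 f x * Dword p.2 g x).sum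
      push_cast
      linarith
  have := gen _ key
  rw [wsplits_length] at this
  push_cast at this
  rw [hC] at this
  linarith

lemma MRNorm_le_of {d : ℕ} (M s : ℕ → ℝ) (hMpos : ∀ p, 0 < M p) (hs : ∀ p, 0 < s p)
    (f : (Fin d → ℝ) → ℂ) (B : ℝ≥0∞) (hB : B ≠ ⊤)
    (h : ∀ k x, ‖Dmulti k f x‖ ≤ B.toReal * wt M s (∑ m, k m)) : MRNorm M s f ≤ B := by
  refine iSup_le fun k => ?_
  change _ / ENNReal.ofReal (wt M s (∑ m, k m)) ≤ B
  have hw := wt_pos M s hMpos hs (∑ m, k m)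
  rw [ENNReal.div_le_iff (by simpa using hw) (by simp)]
  refine iSup_le fun x => ?_
  have h2 := ENNReal.ofReal_le_ofReal (h k x)
  rw [ENNReal.ofReal_mul ENNReal.toReal_nonneg, ENNReal.ofReal_toReal hB] at h2
  refine le_trans (le_of_eq ?_) h2
  rw [ofReal_norm]
  rfl

lemma halfSeq_mem (r : ℕ → ℝ) (hr : IsRSeq r) (h1 : 2 < r 1) : IsRSeq (halfSeq r) := by
  obtain ⟨h0, hp, hm, ht⟩ := hr
  refine ⟨by simp [halfSeq], fun p => ?_, monotone_nat_of_le_succ fun n => ?_, ?_⟩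
  · unfold halfSeq
    split_ifs
    · norm_num
    · have := hp p
      linarith
  · unfold halfSeq
    rcases Nat.eq_zero_or_pos n with rfl | hn
    · simp; linarith
    · rw [if_neg (by omega), if_neg (by omega)]
      have := hm (Nat.le_succ n)
      simp only [Nat.succ_eq_add_one] at this
      linarith
  · refine Filter.Tendsto.congr' ?_ (ht.atTop_div_const (r := 2) (by norm_num))
    filter_upwards [Filter.eventually_ge_atTop 1] with n hn
    simp [halfSeq, show n ≠ 0 by omega]

lemma halfSeq_prod (r : ℕ → ℝ) (h0 : r 0 = 1) (p : ℕ) :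
    2 ^ p * prodSeq (halfSeq r) p = prodSeq r p := by
  induction p with
  | zero => simp [prodSeq, halfSeq, h0]
  | succ p ih =>
    have e : ∀ q : ℕ → ℝ, prodSeq q (p + 1) = prodSeq q p * q (p + 1) := fun q =>
      Finset.prod_range_succ _ _
    rw [e, e, ← ih]
    simp [halfSeq]
    ring

/-- A replacement for half of a sequence, bounded below by one. -/
def maxHalf (s : ℕ → ℝ) : ℕ → ℝ := fun p => max 1 (s p / 2)

lemma maxHalf_mem (s : ℕ → ℝ) (hs : IsRSeq s) : IsRSeq (maxHalf s) := by
  obtain ⟨h0, hp, hm, ht⟩ := hs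
  refine ⟨by simp only [maxHalf, h0]; norm_num, fun p => lt_max_of_lt_left one_pos, ?_, ?_⟩
  · intro a b hab
    have := hm hab
    exact max_le_max le_rfl (by linarith)
  · exact Filter.tendsto_atTop_mono (fun n => le_max_right _ _)
      (ht.atTop_div_const (r := 2) (by norm_num))

lemma maxHalf_prod (s : ℕ → ℝ) (hs : IsRSeq s) :
    ∃ C : ℝ, 0 < C ∧ ∀ p, 2 ^ p * prodSeq (maxHalf s) p ≤ C * prodSeq s p := by
  have hmem := maxHalf_mem s hs
  obtain ⟨h0, hp, hm, ht⟩ := hs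
  obtain ⟨N, hN⟩ := Filter.eventually_atTop.1 (ht.eventually_ge_atTop 2)
  have e : ∀ (q : ℕ → ℝ) p, prodSeq q (p + 1) = prodSeq q p * q (p + 1) := fun q p =>
      Finset.prod_range_succ _ _
  have hQ : ∀ p, 0 < 2 ^ p * prodSeq (maxHalf s) p / prodSeq s p := fun p =>
    div_pos (mul_pos (by positivity) (prodSeq_pos _ hmem.2.1 p)) (prodSeq_pos _ hp p)
  refine ⟨∑ i ∈ Finset.range (N + 1), 2 ^ i * prodSeq (maxHalf s) i / prodSeq s i,
    Finset.sum_pos (fun i _ => hQ i) (by simp), fun p => ?_⟩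
  induction p with
  | zero =>
    rw [← div_le_iff₀ (prodSeq_pos _ hp _)]
    exact Finset.single_le_sum (f := fun i => 2 ^ i * prodSeq (maxHalf s) i / prodSeq s i)
      (fun i _ => (hQ i).le) (by simp)
  | succ p ih =>
    by_cases hpN : p + 1 ≤ N
    · rw [← div_le_iff₀ (prodSeq_pos _ hp _)]
      exact Finset.single_le_sum (f := fun i => 2 ^ i * prodSeq (maxHalf s) i / prodSeq s i)
        (fun i _ => (hQ i).le) (by simp; omega)
    · have h2 := hN (p + 1) (by omega)
      have h3 : maxHalf s (p + 1) = s (p + 1) / 2 := max_eq_right (by linarith)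
      rw [e, e, h3]
      have := mul_le_mul_of_nonneg_right ih (hp (p + 1)).le
      rw [pow_succ]
      linarith

/-- If `φ₁, φ₂` are smooth functions with `‖φ₁‖_{(s_p)} < ∞` and
`‖φ₂‖_{(s_p)} < ∞` for every `(s_p) ∈ 𝔯`, then `‖φ₁ · φ₂‖_{(s_p)} < ∞` for every
`(s_p) ∈ 𝔯`, and for every `(r_p) ∈ 𝔯` with `r 1 > 2` one has
`(r_p)/2 ∈ 𝔯` and `‖φ₁ · φ₂‖_{(r_p)} ≤ ‖φ₁‖_{(r_p)/2} · ‖φ₂‖_{(r_p)/2}`. -/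
theorem stmt9 (d : ℕ) (M : ℕ → ℝ) (hMpos : ∀ p, 0 < M p)
    (hM1 : ∀ p : ℕ, 1 ≤ p → M p ^ 2 ≤ M (p - 1) * M (p + 1)) (hM0 : M 0 = 1)
    (φ₁ φ₂ : (Fin d → ℝ) → ℂ)
    (hφ₁ : ContDiff ℝ (⊤ : ℕ∞) φ₁) (hφ₂ : ContDiff ℝ (⊤ : ℕ∞) φ₂)
    (hfin₁ : ∀ s : ℕ → ℝ, IsRSeq s → MRNorm M s φ₁ < ⊤)
    (hfin₂ : ∀ s : ℕ → ℝ, IsRSeq s → MRNorm M s φ₂ < ⊤) :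
    (∀ s : ℕ → ℝ, IsRSeq s → MRNorm M s (fun x => φ₁ x * φ₂ x) < ⊤) ∧
      ∀ r : ℕ → ℝ, IsRSeq r → 2 < r 1 →
        IsRSeq (halfSeq r) ∧
          MRNorm M r (fun x => φ₁ x * φ₂ x) ≤
            MRNorm M (halfSeq r) φ₁ * MRNorm M (halfSeq r) φ₂ := by
  constructor
  · intro s hs
    have hm := maxHalf_mem s hs
    obtain ⟨C, hC, hCp⟩ := maxHalf_prod s hs
    have hN := ENNReal.mul_ne_top (hfin₁ _ hm).ne (hfin₂ _ hm).ne
    have hB : MRNorm M (maxHalf s) φ₁ * MRNorm M (maxHalf s) φ₂ * ENNReal.ofReal C ≠ ⊤ :=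
      ENNReal.mul_ne_top hN (by simp)
    refine lt_of_le_of_lt (MRNorm_le_of M s hMpos hs.2.1 _ _ hB fun k x => ?_) hB.lt_top
    refine (norm_Dmulti_mul_le M (maxHalf s) hMpos hM1 hM0 hm φ₁ φ₂ hφ₁ hφ₂ (hfin₁ _ hm)
      (hfin₂ _ hm) k x).trans ?_
    rw [ENNReal.toReal_mul (b := ENNReal.ofReal C), ENNReal.toReal_ofReal hC.le, mul_assoc]
    refine mul_le_mul_of_nonneg_left ?_ ENNReal.toReal_nonneg
    have := mul_le_mul_of_nonneg_right (hCp (∑ m, k m)) (hMpos (∑ m, k m)).le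
    unfold wt
    linarith
  · intro r hr h1
    have hm := halfSeq_mem r hr h1
    refine ⟨hm, ?_⟩
    have hN := ENNReal.mul_ne_top (hfin₁ _ hm).ne (hfin₂ _ hm).ne
    refine MRNorm_le_of M r hMpos hr.2.1 _ _ hN fun k x => ?_
    refine (norm_Dmulti_mul_le M (halfSeq r) hMpos hM1 hM0 hm φ₁ φ₂ hφ₁ hφ₂ (hfin₁ _ hm)
      (hfin₂ _ hm) k x).trans (le_of_eq ?_)
    unfold wt
    rw [← halfSeq_prod r hr.1]
    ring
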